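/- arXiv:2101.00677 — 14 statements merged into one kernel-verified Lean document; each statement's English description precedes it below -/
import Mathlib

section
/- Let (L,∨,∧,·,→,1) be an integral commutative residuated lattice and define on L² the operation (x,y)⊙(z,v) := (x·z, (x→v)∧(z→y)). Then (L²,⊙,(1,1)) is a commutative monoid: ⊙ is commutative, associative, and (x,y)⊙(1,1) = (x,y) for all (x,y)∈L². -/
/-- The Busaniche–Cignoli / Tsinakis–Wille product on the full twist-product:
`(x,y) ⊙ (z,v) = (x·z, (x→v) ∧ (z→y))`. -/
def odot {L : Type*} [Lattice L] (mul himp : L → L → L) (p q : L × L) : L × L :=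
  (mul p.1 q.1, himp p.1 q.2 ⊓ himp q.1 p.2)

/-- Residuation preserves binary meets in its second argument. -/
theorem residuum_inf {L : Type*} [Lattice L] {mul himp : L → L → L}
    (hadj : ∀ x y z : L, mul x y ≤ z ↔ x ≤ himp y z) (x y z : L) :
    himp x (y ⊓ z) = himp x y ⊓ himp x z :=
  eq_of_forall_le_iff fun c => by simp only [le_inf_iff, ← hadj]

/-- Currying for the residuum of an associative product. -/
theorem residuum_mul {L : Type*} [Lattice L] {mul himp : L → L → L}
    (hmul_assoc : ∀ x y z : L, mul (mul x y) z = mul x (mul y z))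
    (hadj : ∀ x y z : L, mul x y ≤ z ↔ x ≤ himp y z) (x y z : L) :
    himp (mul x y) z = himp x (himp y z) :=
  eq_of_forall_le_iff fun c => by simp only [← hadj, hmul_assoc]

/-- If `(L,∨,∧,·,→,1)` is an integral commutative residuated lattice, then
`(L², ⊙, (1,1))` is a commutative monoid. -/
theorem stmt_0 {L : Type*} [Lattice L] (one : L) (mul himp : L → L → L)
    (hmul_comm : ∀ x y : L, mul x y = mul y x)
    (hmul_assoc : ∀ x y z : L, mul (mul x y) z = mul x (mul y z))
    (hmul_one : ∀ x : L, mul x one = x)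
    (hadj : ∀ x y z : L, mul x y ≤ z ↔ x ≤ himp y z)
    (htop : ∀ x : L, x ≤ one) :
    (∀ p q : L × L, odot mul himp p q = odot mul himp q p) ∧
    (∀ p q r : L × L,
      odot mul himp (odot mul himp p q) r = odot mul himp p (odot mul himp q r)) ∧
    (∀ p : L × L, odot mul himp p (one, one) = p) := by
  refine ⟨fun p q => ?_, fun p q r => ?_, fun p => ?_⟩
  · exact Prod.ext (hmul_comm _ _) (inf_comm _ _)
  · refine Prod.ext (hmul_assoc _ _ _) ?_
    simp only [odot, residuum_inf hadj]
    rw [residuum_mul hmul_assoc hadj p.1 q.1, hmul_comm q.1 r.1,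
      residuum_mul hmul_assoc hadj r.1 q.1, ← residuum_mul hmul_assoc hadj r.1 p.1,
      hmul_comm r.1 p.1, residuum_mul hmul_assoc hadj p.1 r.1, inf_assoc]
  · have himp_one : himp p.1 one = one :=
      le_antisymm (htop _) ((hadj _ _ _).1 (htop _))
    have one_himp : himp one p.2 = p.2 :=
      eq_of_forall_le_iff fun c => by rw [← hadj, hmul_one]
    refine Prod.ext (hmul_one _) ?_
    simp only [odot, himp_one, one_himp]
    exact inf_eq_right.2 (htop _)
end

section
/- Let (L,∨,∧,·,→,1) be an integral commutative residuated lattice. On L² define (x,y)⊙(z,v) := (x·z, (x→v)∧(z→y)) and (x,y)⇒(z,v) := ((x→z)∧(v→y), x·v), and order L² by (x,y) ≤ (z,v) iff x ≤ z and v ≤ y. Then for all (a,b),(c,d),(e,f)∈L², (a,b)⊙(c,d) ≤ (e,f) if and only if (a,b) ≤ (c,d)⇒(e,f). -/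
/-- The twist order on `L²`: `(x,y) ≤ (z,v)` iff `x ≤ z` and `v ≤ y`. -/
def tle {L : Type*} [Lattice L] (p q : L × L) : Prop :=
  p.1 ≤ q.1 ∧ q.2 ≤ p.2

/-- `(x,y) ⇒ (z,v) = ((x→z) ∧ (v→y), x·v)`. -/
def oimp {L : Type*} [Lattice L] (mul himp : L → L → L) (p q : L × L) : L × L :=
  (himp p.1 q.1 ⊓ himp q.2 p.2, mul p.1 q.2)

/-- In an integral commutative residuated lattice, `⊙` and `⇒` form an adjoint
pair on the full twist-product. -/
theorem stmt_1 {L : Type*} [Lattice L] (one : L) (mul himp : L → L → L)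
    (hmul_comm : ∀ x y : L, mul x y = mul y x)
    (hmul_assoc : ∀ x y z : L, mul (mul x y) z = mul x (mul y z))
    (hmul_one : ∀ x : L, mul x one = x)
    (hadj : ∀ x y z : L, mul x y ≤ z ↔ x ≤ himp y z)
    (htop : ∀ x : L, x ≤ one) :
    ∀ p q r : L × L, tle (odot mul himp p q) r ↔ tle p (oimp mul himp q r) := by
  rintro ⟨a, b⟩ ⟨c, d⟩ ⟨e, f⟩
  simp only [tle, odot, oimp, le_inf_iff, ← hadj]
  rw [hmul_comm f a, hmul_comm f c, and_assoc]
end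

section
/- Let (L,∨,∧) be a lattice, a∈L, and suppose P_a(L) := {(x,y)∈L² : x∧y ≤ a ≤ x∨y} is closed under the operations (x,y)⊔(z,v) = (x∨z, y∧v) and (x,y)⊓(z,v) = (x∧z, y∨v) of the full twist-product. Define (x,y)' := (y,x) on P_a(L). Then (P_a(L),⊔,⊓,') is a pseudo-Kleene lattice: ' is an antitone involution on P_a(L) and u⊓u' ≤ w⊔w' for all u,w∈P_a(L). -/
/-- `P_a(L) = {(x,y) ∈ L² : x∧y ≤ a ≤ x∨y}`. -/
def Pa {L : Type*} [Lattice L] (a : L) : Set (L × L) :=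
  {p | p.1 ⊓ p.2 ≤ a ∧ a ≤ p.1 ⊔ p.2}

/-- The join of the full twist-product: `(x,y) ⊔ (z,v) = (x∨z, y∧v)`. -/
def tsup {L : Type*} [Lattice L] (p q : L × L) : L × L :=
  (p.1 ⊔ q.1, p.2 ⊓ q.2)

/-- The meet of the full twist-product: `(x,y) ⊓ (z,v) = (x∧z, y∨v)`. -/
def tinf {L : Type*} [Lattice L] (p q : L × L) : L × L :=
  (p.1 ⊓ q.1, p.2 ⊔ q.2)

/-- If `P_a(L)` is closed under `⊔` and `⊓` of the full twist-product, then
`(P_a(L), ⊔, ⊓, ')` with `(x,y)' := (y,x)` is a pseudo-Kleene lattice. -/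
theorem stmt_3 {L : Type*} [Lattice L] (a : L)
    (hclosed : ∀ p q : L × L, p ∈ Pa a → q ∈ Pa a →
      tsup p q ∈ Pa a ∧ tinf p q ∈ Pa a) :
    (∀ p : L × L, p ∈ Pa a → p.swap ∈ Pa a) ∧
    (∀ p q : L × L, p ∈ Pa a → q ∈ Pa a → tle p q → tle q.swap p.swap) ∧
    (∀ p : L × L, p ∈ Pa a → p.swap.swap = p) ∧
    (∀ u w : L × L, u ∈ Pa a → w ∈ Pa a →
      tle (tinf u u.swap) (tsup w w.swap)) := by
  refine ⟨fun p hp => ?_, fun p q _ _ h => ⟨h.2, h.1⟩, fun p _ => p.swap_swap,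
    fun u w hu hw => ⟨hu.1.trans hw.2, ?_⟩⟩
  · exact ⟨(inf_comm _ _).le.trans hp.1, hp.2.trans (sup_comm _ _).le⟩
  · exact ((inf_comm _ _).le.trans hw.1).trans (hu.2.trans (sup_comm _ _).le)
end

section
/- Let (L,∨,∧) be a lattice, a∈L, and suppose P_a(L) := {(x,y)∈L² : x∧y ≤ a ≤ x∨y} is closed under the operations ⊔ and ⊓ of the full twist-product. Then (P_a(L),⊔,⊓) is a distributive lattice if and only if (L,∨,∧) is a distributive lattice. -/
/-- If `P_a(L)` is closed under `⊔` and `⊓` of the full twist-product, then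
`(P_a(L), ⊔, ⊓)` is distributive if and only if `L` is distributive. -/
theorem stmt_5 {L : Type*} [Lattice L] (a : L)
    (hclosed : ∀ p q : L × L, p ∈ Pa a → q ∈ Pa a →
      tsup p q ∈ Pa a ∧ tinf p q ∈ Pa a) :
    (∀ p q r : L × L, p ∈ Pa a → q ∈ Pa a → r ∈ Pa a →
      tinf p (tsup q r) = tsup (tinf p q) (tinf p r)) ↔
    (∀ x y z : L, x ⊓ (y ⊔ z) = (x ⊓ y) ⊔ (x ⊓ z)) := by
  constructor
  · intro h x y z
    have mem_left : ∀ w : L, (w, a) ∈ Pa a := fun w => ⟨inf_le_right, le_sup_right⟩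
    exact congrArg Prod.fst (h _ _ _ (mem_left x) (mem_left y) (mem_left z))
  · intro h p q r _ _ _
    let _ : DistribLattice L := DistribLattice.ofInfSupLe fun x y z => (h x y z).le
    exact Prod.ext (h _ _ _) (sup_inf_left p.2 q.2 r.2)
end

section
/- Let (L,∨,∧) be a lattice and a∈L. Then the following are equivalent: (i) every (x,y)∈P_a(L) is comparable with (a,a) in the twist order (i.e. (x ≤ a and a ≤ y) or (a ≤ x and y ≤ a)); (ii) P_a(L) equals the set of all pairs (x,y)∈L² comparable with (a,a) in the twist order; (iii) every element of L is comparable with a, and a is ∨-irreducible (a = x∨y implies a = x or a = y) and ∧-irreducible (a = x∧y implies a = x or a = y). -/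
/-- `(x,y)` is comparable with `(a,a)` in the twist order. -/
def cmpAA {L : Type*} [Lattice L] (a : L) (p : L × L) : Prop :=
  (p.1 ≤ a ∧ a ≤ p.2) ∨ (a ≤ p.1 ∧ p.2 ≤ a)

theorem cmpAA.mem_Pa {L : Type*} [Lattice L] {a : L} {p : L × L} (h : cmpAA a p) : p ∈ Pa a := by
  rcases h with ⟨h₁, h₂⟩ | ⟨h₁, h₂⟩
  · exact ⟨inf_le_left.trans h₁, h₂.trans le_sup_right⟩
  · exact ⟨inf_le_right.trans h₂, h₁.trans le_sup_left⟩

theorem forall_mem_Pa_cmpAA_iff_eq {L : Type*} [Lattice L] (a : L) :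
    (∀ p : L × L, p ∈ Pa a → cmpAA a p) ↔ Pa a = {p : L × L | cmpAA a p} :=
  ⟨fun h => Set.Subset.antisymm h fun _ hp => cmpAA.mem_Pa hp, fun h _ hp => h.subset hp⟩

theorem forall_mem_Pa_cmpAA_iff_irreducible {L : Type*} [Lattice L] (a : L) :
    (∀ p : L × L, p ∈ Pa a → cmpAA a p) ↔
      ((∀ x : L, x ≤ a ∨ a ≤ x) ∧
       (∀ x y : L, a = x ⊔ y → a = x ∨ a = y) ∧
       (∀ x y : L, a = x ⊓ y → a = x ∨ a = y)) := by
  constructor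
  · intro h
    refine ⟨fun x => ?_, fun x y hxy => ?_, fun x y hxy => ?_⟩
    · exact (h (x, a) ⟨inf_le_right, le_sup_right⟩).imp And.left And.left
    · rcases h (x, y) ⟨inf_le_sup.trans hxy.ge, hxy.le⟩ with ⟨-, hy⟩ | ⟨hx, -⟩
      · exact Or.inr (hy.antisymm (le_sup_right.trans hxy.ge))
      · exact Or.inl (hx.antisymm (le_sup_left.trans hxy.ge))
    · rcases h (x, y) ⟨hxy.ge, hxy.le.trans inf_le_sup⟩ with ⟨hx, -⟩ | ⟨-, hy⟩
      · exact Or.inl ((hxy.le.trans inf_le_left).antisymm hx)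
      · exact Or.inr ((hxy.le.trans inf_le_right).antisymm hy)
  · rintro ⟨hcmp, hsup, hinf⟩ ⟨x, y⟩ ⟨hle, hge⟩
    rcases hcmp x with hx | hx <;> rcases hcmp y with hy | hy
    · rcases hsup x y (hge.antisymm (sup_le hx hy)) with h | h
      · exact Or.inr ⟨h.le, hy⟩
      · exact Or.inl ⟨hx, h.le⟩
    · exact Or.inl ⟨hx, hy⟩
    · exact Or.inr ⟨hx, hy⟩
    · rcases hinf x y ((le_inf hx hy).antisymm hle) with h | h
      · exact Or.inl ⟨h.ge, hy⟩
      · exact Or.inr ⟨hx, h.ge⟩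

/-- The following are equivalent: (i) every element of `P_a(L)` is comparable
with `(a,a)`; (ii) `P_a(L)` is exactly the set of pairs comparable with `(a,a)`;
(iii) every element of `L` is comparable with `a`, and `a` is `∨`-irreducible
and `∧`-irreducible. -/
theorem stmt_8 {L : Type*} [Lattice L] (a : L) :
    ((∀ p : L × L, p ∈ Pa a → cmpAA a p) ↔
      Pa a = {p : L × L | cmpAA a p}) ∧
    ((Pa a = {p : L × L | cmpAA a p}) ↔
      ((∀ x : L, x ≤ a ∨ a ≤ x) ∧
       (∀ x y : L, a = x ⊔ y → a = x ∨ a = y) ∧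
       (∀ x y : L, a = x ⊓ y → a = x ∨ a = y))) :=
  ⟨forall_mem_Pa_cmpAA_iff_eq a,
    (forall_mem_Pa_cmpAA_iff_eq a).symm.trans (forall_mem_Pa_cmpAA_iff_irreducible a)⟩
end

section
/- Let (L,∨,∧) be a lattice and a∈L such that every element of L is comparable with a, and a is ∨-irreducible and ∧-irreducible. Then P_a(L) := {(x,y)∈L² : x∧y ≤ a ≤ x∨y} is closed under the operations (x,y)⊔(z,v) = (x∨z, y∧v) and (x,y)⊓(z,v) = (x∧z, y∨v) of the full twist-product. -/
theorem le_sup_iff_of_comparable_of_irreducible {L : Type*} [Lattice L] {a : L}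
    (hcmp : ∀ x : L, x ≤ a ∨ a ≤ x)
    (hirr : ∀ x y : L, a = x ⊔ y → a = x ∨ a = y) (x y : L) :
    a ≤ x ⊔ y ↔ a ≤ x ∨ a ≤ y := by
  refine ⟨fun h => ?_, fun h => h.elim le_sup_of_le_left le_sup_of_le_right⟩
  rcases hcmp x with hx | hx
  · rcases hcmp y with hy | hy
    · exact (hirr x y (le_antisymm h (sup_le hx hy))).imp le_of_eq le_of_eq
    · exact Or.inr hy
  · exact Or.inl hx

theorem inf_le_iff_of_comparable_of_irreducible {L : Type*} [Lattice L] {a : L}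
    (hcmp : ∀ x : L, x ≤ a ∨ a ≤ x)
    (hirr : ∀ x y : L, a = x ⊓ y → a = x ∨ a = y) (x y : L) :
    x ⊓ y ≤ a ↔ x ≤ a ∨ y ≤ a := by
  refine ⟨fun h => ?_, fun h => h.elim inf_le_of_left_le inf_le_of_right_le⟩
  rcases hcmp x with hx | hx
  · exact Or.inl hx
  · rcases hcmp y with hy | hy
    · exact Or.inr hy
    · exact (hirr x y (le_antisymm (le_inf hx hy) h)).imp ge_of_eq ge_of_eq

/-- If every element of `L` is comparable with `a` and `a` is `∨`-irreducible
and `∧`-irreducible, then `P_a(L)` is closed under `⊔` and `⊓` of the full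
twist-product. -/
theorem stmt_9 {L : Type*} [Lattice L] (a : L)
    (hcmp : ∀ x : L, x ≤ a ∨ a ≤ x)
    (hsupirr : ∀ x y : L, a = x ⊔ y → a = x ∨ a = y)
    (hinfirr : ∀ x y : L, a = x ⊓ y → a = x ∨ a = y) :
    ∀ p q : L × L, p ∈ Pa a → q ∈ Pa a →
      tsup p q ∈ Pa a ∧ tinf p q ∈ Pa a := by
  rintro ⟨x, y⟩ ⟨z, v⟩ hp hq
  have hsup := le_sup_iff_of_comparable_of_irreducible hcmp hsupirr
  have hinf := inf_le_iff_of_comparable_of_irreducible hcmp hinfirr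
  simp only [Pa, tsup, tinf, Set.mem_ofPred_eq, hsup, hinf, sup_le_iff, le_inf_iff] at hp hq ⊢
  tauto
end

section
/- Let (L,∨,∧,·,→,0,1) be an integral commutative residuated lattice with bottom element 0, and let a∈L satisfy a·a = a, be comparable with every element of L, and be ∨-irreducible and ∧-irreducible. Then P_a(L) is closed under the operations (x,y)⊙(z,v) := (x·z, (x→v)∧(z→y)) and (x,y)⇒(z,v) := ((x→z)∧(v→y), x·v) if and only if the following two conditions hold for all x,y∈L: (3) a·x < a implies a·x = 0, and (4) a < x·y implies (x→a)∧(y→a) = a. -/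
theorem mem_Pa_iff {L : Type*} [Lattice L] {a : L}
    (hcmp : ∀ x : L, x ≤ a ∨ a ≤ x)
    (hsupirr : ∀ x y : L, a = x ⊔ y → a = x ∨ a = y)
    (hinfirr : ∀ x y : L, a = x ⊓ y → a = x ∨ a = y) (x y : L) :
    (x, y) ∈ Pa a ↔ (x ≤ a ∧ a ≤ y) ∨ (y ≤ a ∧ a ≤ x) := by
  constructor
  · rintro ⟨hinf, hsup⟩
    rcases hcmp x with hx | hx <;> rcases hcmp y with hy | hy
    · rcases hsupirr x y (le_antisymm hsup (sup_le hx hy)) with h | h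
      · exact Or.inr ⟨hy, h.le⟩
      · exact Or.inl ⟨hx, h.le⟩
    · exact Or.inl ⟨hx, hy⟩
    · exact Or.inr ⟨hy, hx⟩
    · rcases hinfirr x y (le_antisymm (le_inf hx hy) hinf) with h | h
      · exact Or.inl ⟨h.ge, hy⟩
      · exact Or.inr ⟨h.ge, hx⟩
  · rintro (⟨hx, hy⟩ | ⟨hy, hx⟩)
    · exact ⟨inf_le_of_left_le hx, le_sup_of_le_right hy⟩
    · exact ⟨inf_le_of_right_le hy, le_sup_of_le_left hx⟩

theorem swap_mem_Pa {L : Type*} [Lattice L] {a : L} {p : L × L} (hp : p ∈ Pa a) :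
    p.swap ∈ Pa a :=
  ⟨(inf_comm p.2 p.1).trans_le hp.1, hp.2.trans_eq (sup_comm p.1 p.2)⟩

/-- Let `L` be an integral commutative residuated lattice with bottom `0`, and
let `a` be idempotent, comparable with every element, `∨`-irreducible and
`∧`-irreducible. Then `P_a(L)` is closed under `⊙` and `⇒` iff conditions (3)
and (4) hold. -/
theorem stmt_10 {L : Type*} [Lattice L] (zero one a : L) (mul himp : L → L → L)
    (hmul_comm : ∀ x y : L, mul x y = mul y x)
    (hmul_assoc : ∀ x y z : L, mul (mul x y) z = mul x (mul y z))
    (hmul_one : ∀ x : L, mul x one = x)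
    (hadj : ∀ x y z : L, mul x y ≤ z ↔ x ≤ himp y z)
    (htop : ∀ x : L, x ≤ one)
    (hbot : ∀ x : L, zero ≤ x)
    (hidem : mul a a = a)
    (hcmp : ∀ x : L, x ≤ a ∨ a ≤ x)
    (hsupirr : ∀ x y : L, a = x ⊔ y → a = x ∨ a = y)
    (hinfirr : ∀ x y : L, a = x ⊓ y → a = x ∨ a = y) :
    ((∀ p q : L × L, p ∈ Pa a → q ∈ Pa a → odot mul himp p q ∈ Pa a) ∧
     (∀ p q : L × L, p ∈ Pa a → q ∈ Pa a → oimp mul himp p q ∈ Pa a)) ↔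
    ((∀ x : L, mul a x < a → mul a x = zero) ∧
     (∀ x y : L, a < mul x y → himp x a ⊓ himp y a = a)) := by
  have hmem := mem_Pa_iff hcmp hsupirr hinfirr
  have hmono_left {x y : L} (z : L) (h : x ≤ y) : mul x z ≤ mul y z :=
    (hadj x z _).2 (h.trans ((hadj y z _).1 le_rfl))
  have hmono_right {x y : L} (z : L) (h : x ≤ y) : mul z x ≤ mul z y := by
    rw [hmul_comm z x, hmul_comm z y]
    exact hmono_left z h
  have hmul_le_left (x y : L) : mul x y ≤ x :=
    (hmono_right x (htop y)).trans_eq (hmul_one x)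
  have hmul_le_right (x y : L) : mul x y ≤ y :=
    (hmul_comm x y).trans_le (hmul_le_left y x)
  have hle_himp {y : L} (x : L) (hy : a ≤ y) : a ≤ himp x y :=
    (hadj a x y).1 ((hmul_le_left a x).trans hy)
  have hhimp_mono {y z : L} (x : L) (h : y ≤ z) : himp x y ≤ himp x z :=
    (hadj _ x z).1 (((hadj _ x y).2 le_rfl).trans h)
  constructor
  · rintro ⟨hodot, -⟩
    refine ⟨fun x hx => ?_, fun x y hxy => ?_⟩
    · have hxa : x ≤ a := (hcmp x).resolve_right fun h =>
        hx.not_ge (hidem.symm.trans_le (hmono_right a h))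
      have h := hodot (a, zero) (x, a) ((hmem _ _).2 (Or.inr ⟨hbot a, le_rfl⟩))
        ((hmem _ _).2 (Or.inl ⟨hxa, le_rfl⟩))
      rcases (hmem _ _).1 h with ⟨-, h⟩ | ⟨-, h⟩
      · exact le_antisymm ((hadj a x zero).2 (h.trans inf_le_right)) (hbot _)
      · exact absurd h hx.not_ge
    · have h := hodot (x, a) (y, a)
        ((hmem _ _).2 (Or.inr ⟨le_rfl, hxy.le.trans (hmul_le_left x y)⟩))
        ((hmem _ _).2 (Or.inr ⟨le_rfl, hxy.le.trans (hmul_le_right x y)⟩))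
      rcases (hmem _ _).1 h with ⟨h, -⟩ | ⟨h, -⟩
      · exact absurd h hxy.not_ge
      · exact le_antisymm h (le_inf (hle_himp x le_rfl) (hle_himp y le_rfl))
  · rintro ⟨hzero, hhimp⟩
    have hmixed {x z v : L} (hx : x ≤ a) (hz : a ≤ z) : a ≤ himp x v ∨ mul x z = a := by
      rcases (hmul_le_left a x).lt_or_eq with h | h
      · exact Or.inl ((hadj a x v).1 ((hzero x h).trans_le (hbot v)))
      · obtain rfl : x = a := le_antisymm hx (h.symm.trans_le (hmul_le_right a x))
        exact Or.inr (le_antisymm (hmul_le_left x z)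
          (hidem.symm.trans_le (hmono_right x hz)))
    have hmem_of_eq {x y : L} (hx : x = a) : (x, y) ∈ Pa a :=
      (hmem _ _).2 ((hcmp y).elim (fun h => Or.inr ⟨h, hx.ge⟩) (fun h => Or.inl ⟨hx.le, h⟩))
    have hodot (p q : L × L) (hp : p ∈ Pa a) (hq : q ∈ Pa a) : odot mul himp p q ∈ Pa a := by
      obtain ⟨x, y⟩ := p
      obtain ⟨z, v⟩ := q
      change (mul x z, himp x v ⊓ himp z y) ∈ Pa a
      rcases (hmem _ _).1 hp with ⟨hx, hy⟩ | ⟨hy, hx⟩ <;>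
        rcases (hmem _ _).1 hq with ⟨hz, hv⟩ | ⟨hv, hz⟩
      · exact (hmem _ _).2 (Or.inl ⟨(hmul_le_left x z).trans hx,
          le_inf (hle_himp x hv) (hle_himp z hy)⟩)
      · rcases hmixed (v := v) hx hz with h | h
        · exact (hmem _ _).2 (Or.inl ⟨(hmul_le_left x z).trans hx, le_inf h (hle_himp z hy)⟩)
        · exact hmem_of_eq h
      · rcases hmixed (v := y) hz hx with h | h
        · exact (hmem _ _).2 (Or.inl ⟨(hmul_le_right x z).trans hz, le_inf (hle_himp x hv) h⟩)
        · exact hmem_of_eq ((hmul_comm x z).trans h)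
      · have haxz : a ≤ mul x z :=
          hidem.symm.trans_le ((hmono_left a hx).trans (hmono_right x hz))
        rcases haxz.lt_or_eq with h | h
        · exact (hmem _ _).2 (Or.inr ⟨(inf_le_inf (hhimp_mono x hv) (hhimp_mono z hy)).trans_eq
            (hhimp x z h), haxz⟩)
        · exact hmem_of_eq h.symm
    exact ⟨hodot, fun p q hp hq => swap_mem_Pa (hodot p q.swap hp (swap_mem_Pa hq))⟩
end

section
/- Let (L,∨,∧,·,→,0,1) be a bounded commutative residuated lattice whose underlying lattice is distributive, and let a be an atom of L (0 < a and no element lies strictly between 0 and a). Then P_a(L) is closed under the operation (x,y)⊙(z,v) := (x·z, (x→v)∧(z→y)) if and only if for all (b,c),(d,e)∈P_a(L), either (i) (b·d)∧(b→e)∧(d→c) = a, or (ii) (b·d)∧(b→e)∧(d→c) = 0 and (a ≤ b·d or a ≤ (b→e)∧(d→c)). -/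
/-- Let `L` be a bounded commutative residuated lattice whose underlying
lattice is distributive and let `a` be an atom of `L`. Then `P_a(L)` is closed
under `⊙` iff for all `(b,c),(d,e) ∈ P_a(L)` either
`(b·d)∧(b→e)∧(d→c) = a`, or `(b·d)∧(b→e)∧(d→c) = 0` and
(`a ≤ b·d` or `a ≤ (b→e)∧(d→c)`). -/
theorem stmt_12 {L : Type*} [DistribLattice L] (zero one a : L)
    (mul himp : L → L → L)
    (hmul_comm : ∀ x y : L, mul x y = mul y x)
    (hmul_assoc : ∀ x y z : L, mul (mul x y) z = mul x (mul y z))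
    (hmul_one : ∀ x : L, mul x one = x)
    (hadj : ∀ x y z : L, mul x y ≤ z ↔ x ≤ himp y z)
    (htop : ∀ x : L, x ≤ one)
    (hbot : ∀ x : L, zero ≤ x)
    (hapos : zero < a)
    (hatom : ∀ x : L, x < a → x = zero) :
    (∀ p q : L × L, p ∈ Pa a → q ∈ Pa a → odot mul himp p q ∈ Pa a) ↔
    (∀ b c d e : L, ((b, c) : L × L) ∈ Pa a → ((d, e) : L × L) ∈ Pa a →
      mul b d ⊓ (himp b e ⊓ himp d c) = a ∨
      (mul b d ⊓ (himp b e ⊓ himp d c) = zero ∧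
        (a ≤ mul b d ∨ a ≤ himp b e ⊓ himp d c))) := by
  have join_prime : ∀ x y : L, a ≤ x ⊔ y → a ≤ x ∨ a ≤ y := by
    intro x y h
    by_contra! hn
    have hx : a ⊓ x = zero := hatom _ (inf_lt_left.2 hn.1)
    have hy : a ⊓ y = zero := hatom _ (inf_lt_left.2 hn.2)
    have key : a = zero := by
      rw [← inf_eq_left.2 h, inf_sup_left, hx, hy, sup_idem]
    exact hapos.ne' key
  constructor
  · intro h b c d e hbc hde
    obtain ⟨hinf, hsup⟩ := h (b, c) (d, e) hbc hde
    exact hinf.eq_or_lt.imp_right fun hlt => ⟨hatom _ hlt, join_prime _ _ hsup⟩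
  · rintro h ⟨b, c⟩ ⟨d, e⟩ hbc hde
    rcases h b c d e hbc hde with heq | ⟨hz, hle⟩
    · exact ⟨heq.le, heq.ge.trans inf_le_sup⟩
    · exact ⟨hz.le.trans (hbot a), hle.elim le_sup_of_le_left le_sup_of_le_right⟩
end

section
/- Let (L,∨,∧,·,→,0,1) be a bounded commutative residuated lattice whose underlying lattice is distributive, and let a be an atom of L. Then P_a(L) is closed under the operation (x,y)⇒(z,v) := ((x→z)∧(v→y), x·v) if and only if for all (b,c),(d,e)∈P_a(L), either (i) (b→d)∧(e→c)∧(b·e) = a, or (ii) (b→d)∧(e→c)∧(b·e) = 0 and (a ≤ (b→d)∧(e→c) or a ≤ b·e). -/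
/-- In a distributive lattice with least element `zero`, an atom `a` satisfies
`x ⊓ y ≤ a ≤ x ⊔ y` iff `x ⊓ y` is `a`, or it is `zero` and `a` lies below `x` or `y`. -/
theorem mem_Pa_iff_of_atom {L : Type*} [DistribLattice L] {zero a : L}
    (hbot : ∀ x : L, zero ≤ x) (hatom : ∀ x : L, x < a → x = zero) (x y : L) :
    (x, y) ∈ Pa a ↔ x ⊓ y = a ∨ (x ⊓ y = zero ∧ (a ≤ x ∨ a ≤ y)) := by
  constructor
  · rintro ⟨hinf, hsup⟩
    change x ⊓ y ≤ a at hinf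
    change a ≤ x ⊔ y at hsup
    rcases hinf.eq_or_lt with h | h
    · exact Or.inl h
    · refine Or.inr ⟨hatom _ h, ?_⟩
      by_cases hx : a ≤ x
      · exact Or.inl hx
      · right
        have hax : a ⊓ x = zero := hatom _ (inf_lt_left.mpr hx)
        calc a ≤ a ⊓ (x ⊔ y) := le_inf le_rfl hsup
          _ = zero ⊔ a ⊓ y := by rw [inf_sup_left, hax]
          _ ≤ y := sup_le (hbot y) inf_le_right
  · rintro (h | ⟨h, hx | hy⟩)
    · exact ⟨h.le, h.ge.trans (inf_le_left.trans le_sup_left)⟩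
    · exact ⟨h.le.trans (hbot a), hx.trans le_sup_left⟩
    · exact ⟨h.le.trans (hbot a), hy.trans le_sup_right⟩

/-- Let `L` be a bounded commutative residuated lattice whose underlying
lattice is distributive and let `a` be an atom of `L`. Then `P_a(L)` is closed
under `⇒` iff for all `(b,c),(d,e) ∈ P_a(L)` either
`(b→d)∧(e→c)∧(b·e) = a`, or `(b→d)∧(e→c)∧(b·e) = 0` and
(`a ≤ (b→d)∧(e→c)` or `a ≤ b·e`). -/
theorem stmt_13 {L : Type*} [DistribLattice L] (zero one a : L)
    (mul himp : L → L → L)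
    (hmul_comm : ∀ x y : L, mul x y = mul y x)
    (hmul_assoc : ∀ x y z : L, mul (mul x y) z = mul x (mul y z))
    (hmul_one : ∀ x : L, mul x one = x)
    (hadj : ∀ x y z : L, mul x y ≤ z ↔ x ≤ himp y z)
    (htop : ∀ x : L, x ≤ one)
    (hbot : ∀ x : L, zero ≤ x)
    (hapos : zero < a)
    (hatom : ∀ x : L, x < a → x = zero) :
    (∀ p q : L × L, p ∈ Pa a → q ∈ Pa a → oimp mul himp p q ∈ Pa a) ↔
    (∀ b c d e : L, ((b, c) : L × L) ∈ Pa a → ((d, e) : L × L) ∈ Pa a →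
      (himp b d ⊓ himp e c) ⊓ mul b e = a ∨
      ((himp b d ⊓ himp e c) ⊓ mul b e = zero ∧
        (a ≤ himp b d ⊓ himp e c ∨ a ≤ mul b e))) := by
  have key := mem_Pa_iff_of_atom hbot hatom
  constructor
  · intro h b c d e hp hq
    exact (key _ _).mp (h (b, c) (d, e) hp hq)
  · rintro h ⟨b, c⟩ ⟨d, e⟩ hp hq
    exact (key _ _).mpr (h b c d e hp hq)
end

section
/- Let (L,∨,∧,·,→,0,1) be a bounded commutative residuated lattice satisfying the double negation law (x→0)→0 = x. On L² define (x,y)⇒(z,v) := ((x→z)∧(v→y), x·v) and (x,y)' := (x,y)⇒(0,1). Then for all (x,y)∈L² with x and y orthogonal (i.e. x ≤ y→0): (x,y)' = (y,x) and (x,y)'' = (x,y). -/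
/-- Let `L` be a bounded commutative residuated lattice satisfying the double
negation law, and define `(x,y)' := (x,y) ⇒ (0,1)` on `L²`. Then for all
orthogonal `x, y` (that is, `x ≤ y→0`): `(x,y)' = (y,x)` and `(x,y)'' = (x,y)`. -/
theorem stmt_14 {L : Type*} [Lattice L] (zero one : L) (mul himp : L → L → L)
    (hmul_comm : ∀ x y : L, mul x y = mul y x)
    (hmul_assoc : ∀ x y z : L, mul (mul x y) z = mul x (mul y z))
    (hmul_one : ∀ x : L, mul x one = x)
    (hadj : ∀ x y z : L, mul x y ≤ z ↔ x ≤ himp y z)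
    (htop : ∀ x : L, x ≤ one)
    (hbot : ∀ x : L, zero ≤ x)
    (hdn : ∀ x : L, himp (himp x zero) zero = x) :
    ∀ x y : L, x ≤ himp y zero →
      oimp mul himp (x, y) (zero, one) = (y, x) ∧
      oimp mul himp (oimp mul himp (x, y) (zero, one)) (zero, one) = (x, y) := by
  have himp_one (y : L) : himp one y = y := by
    refine le_antisymm ?_ ?_
    · have h := (hadj (himp one y) one y).2 le_rfl
      rwa [hmul_one] at h
    · exact (hadj y one y).1 (hmul_one y).le
  have hswap (x y : L) (h : x ≤ himp y zero) : y ≤ himp x zero := by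
    rw [← hadj, hmul_comm, hadj]
    exact h
  have hcompl (x y : L) (h : x ≤ himp y zero) :
      oimp mul himp (x, y) (zero, one) = (y, x) := by
    simp only [oimp, himp_one, hmul_one, inf_eq_right.2 (hswap x y h)]
  intro x y h
  exact ⟨hcompl x y h, by rw [hcompl x y h, hcompl y x (hswap x y h)]⟩
end

section
/- Let (L,∨,∧,·,→,0,1) be a bounded commutative residuated lattice satisfying the double negation law, write x' := x→0, and define on L² the operations (x,y)⊙(z,v) := (x·z, (y'·v')') and (x,y)⇒(z,v) := (x→z, (y'→v')'). Then, with the twist order (x,y) ≤ (z,v) iff x ≤ z and v ≤ y, for all (a,b),(c,d),(e,f)∈L²: (a,b)⊙(c,d) ≤ (e,f) if and only if (a,b) ≤ (c,d)⇒(e,f). -/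
/-- The alternative product `(x,y) ⊙ (z,v) = (x·z, (y'·v')')` where `x' = x→0`. -/
def odotAlt {L : Type*} [Lattice L] (zero : L) (mul himp : L → L → L)
    (p q : L × L) : L × L :=
  (mul p.1 q.1, himp (mul (himp p.2 zero) (himp q.2 zero)) zero)

/-- The alternative implication `(x,y) ⇒ (z,v) = (x→z, (y'→v')')` where `x' = x→0`. -/
def oimpAlt {L : Type*} [Lattice L] (zero : L) (mul himp : L → L → L)
    (p q : L × L) : L × L :=
  (himp p.1 q.1, himp (himp (himp p.2 zero) (himp q.2 zero)) zero)

/-- Let `L` be a bounded commutative residuated lattice satisfying the double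
negation law. Then the alternative operations `⊙` and `⇒` form an adjoint pair
on `L²` with respect to the twist order. -/
theorem stmt_15 {L : Type*} [Lattice L] (zero one : L) (mul himp : L → L → L)
    (hmul_comm : ∀ x y : L, mul x y = mul y x)
    (hmul_assoc : ∀ x y z : L, mul (mul x y) z = mul x (mul y z))
    (hmul_one : ∀ x : L, mul x one = x)
    (hadj : ∀ x y z : L, mul x y ≤ z ↔ x ≤ himp y z)
    (htop : ∀ x : L, x ≤ one)
    (hbot : ∀ x : L, zero ≤ x)
    (hdn : ∀ x : L, himp (himp x zero) zero = x) :
    ∀ p q r : L × L,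
      tle (odotAlt zero mul himp p q) r ↔ tle p (oimpAlt zero mul himp q r) := by
  have le_neg_comm (x y : L) : x ≤ himp y zero ↔ y ≤ himp x zero := by
    rw [← hadj, hmul_comm, hadj]
  have neg_le_comm (x y : L) : himp x zero ≤ y ↔ himp y zero ≤ x := by
    rw [← hdn y, le_neg_comm, hdn x, hdn y]
  intro p q r
  refine and_congr (hadj _ _ _) ?_
  change r.2 ≤ himp (mul (himp p.2 zero) (himp q.2 zero)) zero ↔
    himp (himp (himp q.2 zero) (himp r.2 zero)) zero ≤ p.2
  rw [le_neg_comm, hadj, neg_le_comm]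
end

section
/- Let (L,∨,∧,·,→,0,1) be a bounded commutative residuated lattice satisfying the double negation law, write x' := x→0, and define on L² the operations (x,y)⊙(z,v) := (x·z, (y'·v')') and (x,y)⇒(z,v) := (x→z, (y'→v')'). Then (L²,⊙,(1,0)) is a commutative monoid (⊙ is commutative, associative, and (x,y)⊙(1,0) = (x,y)), (1,0) and (0,1) are the top and bottom elements of L² in the twist order, and the double negation law holds on L²: ((x,y)⇒(0,1))⇒(0,1) = (x,y) for all (x,y)∈L²; moreover (x,y)⇒(0,1) = (x',y'). -/
/-- Let `L` be a bounded commutative residuated lattice satisfying the double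
negation law. Then `(L², ⊙, (1,0))` is a commutative monoid, `(1,0)` and `(0,1)`
are the top and bottom elements of the twist order, the double negation law
holds on `L²` with `(x,y)' := (x,y) ⇒ (0,1)`, and moreover
`(x,y) ⇒ (0,1) = (x', y')`. -/
theorem stmt_16 {L : Type*} [Lattice L] (zero one : L) (mul himp : L → L → L)
    (hmul_comm : ∀ x y : L, mul x y = mul y x)
    (hmul_assoc : ∀ x y z : L, mul (mul x y) z = mul x (mul y z))
    (hmul_one : ∀ x : L, mul x one = x)
    (hadj : ∀ x y z : L, mul x y ≤ z ↔ x ≤ himp y z)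
    (htop : ∀ x : L, x ≤ one)
    (hbot : ∀ x : L, zero ≤ x)
    (hdn : ∀ x : L, himp (himp x zero) zero = x) :
    (∀ p q : L × L, odotAlt zero mul himp p q = odotAlt zero mul himp q p) ∧
    (∀ p q r : L × L, odotAlt zero mul himp (odotAlt zero mul himp p q) r =
      odotAlt zero mul himp p (odotAlt zero mul himp q r)) ∧
    (∀ p : L × L, odotAlt zero mul himp p (one, zero) = p) ∧
    (∀ p : L × L, tle p ((one, zero) : L × L)) ∧
    (∀ p : L × L, tle ((zero, one) : L × L) p) ∧
    (∀ p : L × L, oimpAlt zero mul himp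
      (oimpAlt zero mul himp p (zero, one)) (zero, one) = p) ∧
    (∀ p : L × L, oimpAlt zero mul himp p (zero, one) =
      (himp p.1 zero, himp p.2 zero)) := by
  have h_zero : himp zero zero = one :=
    le_antisymm (htop _) ((hadj _ _ _).1 (by rw [hmul_comm, hmul_one]))
  have h_one : himp one zero = zero := by rw [← h_zero, hdn]
  have h_neg : ∀ p : L × L, oimpAlt zero mul himp p (zero, one) =
      (himp p.1 zero, himp p.2 zero) := fun p => by
    simp only [oimpAlt, h_one, hdn]
  refine ⟨fun p q => ?_, fun p q r => ?_, fun p => ?_, fun p => ⟨htop _, hbot _⟩,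
    fun p => ⟨hbot _, htop _⟩, fun p => ?_, h_neg⟩
  · simp only [odotAlt, hmul_comm p.1, hmul_comm (himp p.2 zero)]
  · simp only [odotAlt, hdn, hmul_assoc]
  · simp only [odotAlt, h_zero, hmul_one, hdn]
  · simp only [h_neg, hdn]
end

section
/- Let (L,∨,∧,') be a lattice with an antitone involution and a∈L with a' = a. Suppose P_a(L) := {(x,y)∈L² : x∧y ≤ a ≤ x∨y} is closed under the operations ⊔ and ⊓ of the full twist-product, and define (x,y)' := (x',y') on L². Then (P_a(L),⊔,⊓,') is a pseudo-Kleene lattice (in particular P_a(L) is closed under ', ' is an antitone involution on P_a(L), and u⊓u' ≤ w⊔w' for all u,w∈P_a(L)) if and only if (L,∨,∧,') is a pseudo-Kleene lattice. -/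
theorem neg_inf_neg_le {L : Type*} [Lattice L] {a x y : L} (neg : L → L)
    (hanti : ∀ x y : L, x ≤ y → neg y ≤ neg x) (hinv : ∀ x : L, neg (neg x) = x)
    (hfix : neg a = a) (h : a ≤ x ⊔ y) : neg x ⊓ neg y ≤ a := by
  have hx : x ≤ neg (neg x ⊓ neg y) := by
    simpa only [hinv] using hanti _ _ (inf_le_left : neg x ⊓ neg y ≤ neg x)
  have hy : y ≤ neg (neg x ⊓ neg y) := by
    simpa only [hinv] using hanti _ _ (inf_le_right : neg x ⊓ neg y ≤ neg y)
  simpa only [hinv, hfix] using hanti _ _ (h.trans (sup_le hx hy))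

theorem le_neg_sup_neg {L : Type*} [Lattice L] {a x y : L} (neg : L → L)
    (hanti : ∀ x y : L, x ≤ y → neg y ≤ neg x) (hinv : ∀ x : L, neg (neg x) = x)
    (hfix : neg a = a) (h : x ⊓ y ≤ a) : a ≤ neg x ⊔ neg y :=
  neg_inf_neg_le (L := Lᵒᵈ) neg (fun x y => hanti y x) hinv hfix h


/-- The componentwise involution `(x,y)' = (x',y')` on `L²`. -/
def negP {L : Type*} (neg : L → L) (p : L × L) : L × L :=
  (neg p.1, neg p.2)

/-- Let `(L,∨,∧,')` be a lattice with an antitone involution, `a' = a`, and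
suppose `P_a(L)` is closed under `⊔` and `⊓` of the full twist-product. With
`(x,y)' := (x',y')`, the algebra `(P_a(L),⊔,⊓,')` is a pseudo-Kleene lattice
iff `(L,∨,∧,')` is a pseudo-Kleene lattice. -/
theorem stmt_17 {L : Type*} [Lattice L] (a : L) (neg : L → L)
    (hanti : ∀ x y : L, x ≤ y → neg y ≤ neg x)
    (hinv : ∀ x : L, neg (neg x) = x)
    (hfix : neg a = a)
    (hclosed : ∀ p q : L × L, p ∈ Pa a → q ∈ Pa a →
      tsup p q ∈ Pa a ∧ tinf p q ∈ Pa a) :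
    ((∀ p : L × L, p ∈ Pa a → negP neg p ∈ Pa a) ∧
     (∀ p q : L × L, p ∈ Pa a → q ∈ Pa a →
       tle p q → tle (negP neg q) (negP neg p)) ∧
     (∀ p : L × L, p ∈ Pa a → negP neg (negP neg p) = p) ∧
     (∀ u w : L × L, u ∈ Pa a → w ∈ Pa a →
       tle (tinf u (negP neg u)) (tsup w (negP neg w)))) ↔
    (∀ x y : L, x ⊓ neg x ≤ y ⊔ neg y) := by
  constructor
  · rintro ⟨-, -, -, hkleene⟩ x y
    exact (hkleene (x, a) (y, a) ⟨inf_le_right, le_sup_right⟩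
      ⟨inf_le_right, le_sup_right⟩).1
  · intro hkleene
    refine ⟨?_, ?_, ?_, fun u w _ _ => ⟨hkleene u.1 w.1, hkleene w.2 u.2⟩⟩
    · rintro ⟨x, y⟩ ⟨hinf, hsup⟩
      exact ⟨neg_inf_neg_le neg hanti hinv hfix hsup,
        le_neg_sup_neg neg hanti hinv hfix hinf⟩
    · rintro p q - - ⟨h₁, h₂⟩
      exact ⟨hanti _ _ h₁, hanti _ _ h₂⟩
    · intro p _
      exact Prod.ext (hinv p.1) (hinv p.2)
end

section
/- Let (L,∨,∧,·,→,0,1) be a bounded commutative residuated lattice equipped with an antitone involution ', let a∈L, and define (x,y)⇒(z,v) := (x→z, (y'→v')') on L². Then P_a(L) := {(x,y)∈L² : x∧y ≤ a ≤ x∨y} is closed under ⇒ if and only if L has exactly one element (equivalently, 0 = 1). -/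
/-- The alternative implication `(x,y) ⇒ (z,v) = (x→z, (y'→v')')` built from an
antitone involution `'`. -/
def oimpInv {L : Type*} (himp : L → L → L) (neg : L → L) (p q : L × L) : L × L :=
  (himp p.1 q.1, neg (himp (neg p.2) (neg q.2)))

/-- Let `L` be a bounded commutative residuated lattice with an antitone
involution `'` and let `a ∈ L`. Then `P_a(L)` is closed under
`(x,y) ⇒ (z,v) = (x→z, (y'→v')')` iff `L` has exactly one element. -/
theorem stmt_19 {L : Type*} [Lattice L] (zero one a : L) (mul himp : L → L → L)
    (neg : L → L)
    (hmul_comm : ∀ x y : L, mul x y = mul y x)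
    (hmul_assoc : ∀ x y z : L, mul (mul x y) z = mul x (mul y z))
    (hmul_one : ∀ x : L, mul x one = x)
    (hadj : ∀ x y z : L, mul x y ≤ z ↔ x ≤ himp y z)
    (htop : ∀ x : L, x ≤ one)
    (hbot : ∀ x : L, zero ≤ x)
    (hanti : ∀ x y : L, x ≤ y → neg y ≤ neg x)
    (hinv : ∀ x : L, neg (neg x) = x) :
    (∀ p q : L × L, p ∈ Pa a → q ∈ Pa a → oimpInv himp neg p q ∈ Pa a) ↔
    (∀ x y : L, x = y) := by
  constructor
  · intro h
    have hneg_zero : neg zero = one :=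
      le_antisymm (htop _) (by simpa only [hinv] using hanti _ _ (hbot (neg one)))
    have hneg_one : neg one = zero := by rw [← hneg_zero, hinv]
    have hone_mul : ∀ x, mul one x = x := fun x => by rw [hmul_comm, hmul_one]
    have hself : ∀ x, himp x x = one := fun x =>
      le_antisymm (htop _) ((hadj _ _ _).1 (hone_mul x).le)
    have hone_imp : himp one zero = zero :=
      le_antisymm (by rw [← hmul_one (himp one zero), hadj]) (hbot _)
    have mem_left : ∀ y, (a, y) ∈ Pa a := fun y => ⟨inf_le_left, le_sup_left⟩
    have mem_zero_one : (zero, one) ∈ Pa a :=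
      ⟨inf_le_left.trans (hbot a), (htop a).trans le_sup_right⟩
    -- `(a,0) ⇒ (a,1) = (1,1)` forces `a = 1`
    have h1 := (h _ _ (mem_left zero) (mem_left one)).1
    simp only [oimpInv, hself, hneg_zero, hneg_one, hone_imp, inf_idem] at h1
    obtain rfl : a = one := le_antisymm (htop a) h1
    -- `(1,1) ⇒ (0,1) = (0,0)` forces `1 = 0`
    have h2 := (h _ _ (mem_left a) mem_zero_one).2
    simp only [oimpInv, hself, hneg_one, hone_imp, sup_idem] at h2
    exact fun x y => le_antisymm ((htop x).trans (h2.trans (hbot y)))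
      ((htop y).trans (h2.trans (hbot x)))
  · intro h p q _ _
    exact ⟨(h _ _).le, (h _ _).le⟩
end
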